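/- Let G ⊆ GL_n(F_p) fix a hyperplane pointwise, with transvection root space dimension ℓ and maximal semisimple order e. Then Hilb((S/𝔪^{[p^m]})^G, t) = ((1−t^{p^m})/(1−t))^{n−ℓ−1} · ((1−t^{p^m})/(1−t^p))^ℓ · ( (1−t^{p^m−1})/(1−t^e) + t^{p^m−1}·((1−t^p)/(1−t))^ℓ ). -/

import Mathlib

open MvPolynomial Matrix

/-- The `m`-th Frobenius power of the irrelevant ideal, `(x_1^N, …, x_n^N)`. -/
noncomputable def frobIdeal (F : Type) [Field F] (n N : ℕ) : Ideal (MvPolynomial (Fin n) F) :=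
  Ideal.span (Set.range fun i : Fin n => (X i : MvPolynomial (Fin n) F) ^ N)

/-- The substitution action of `g ∈ GL_n(F)` on polynomials: `x_i ↦ Σ_j g_{ij} x_j`. -/
noncomputable def gSub {F : Type} [Field F] {n : ℕ} (g : GL (Fin n) F) :
    MvPolynomial (Fin n) F →ₐ[F] MvPolynomial (Fin n) F :=
  aeval fun i => ∑ j, C ((g : Matrix (Fin n) (Fin n) F) i j) * X j

/-- Polynomials `f` with `g·f ≡ f mod (x_1^N,…,x_n^N)` for all `g ∈ G`. -/
noncomputable def invLift {F : Type} [Field F] {n : ℕ} (G : Subgroup (GL (Fin n) F)) (N : ℕ) :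
    Submodule F (MvPolynomial (Fin n) F) :=
  ⨅ g ∈ G, Submodule.comap ((gSub g).toLinearMap - LinearMap.id)
    ((frobIdeal F n N).restrictScalars F)

/-- Dimension of the degree-`d` graded piece of the `G`-invariants in
`S/(x_1^N,…,x_n^N)`. -/
noncomputable def invPieceDim {F : Type} [Field F] {n : ℕ} (G : Subgroup (GL (Fin n) F))
    (N d : ℕ) : ℕ :=
  Module.finrank F ((homogeneousSubmodule (Fin n) F d ⊓ invLift G N).map
    (Ideal.Quotient.mkₐ F (frobIdeal F n N)).toLinearMap)

/-- The Hilbert series of the `G`-invariants in `S/(x_1^N,…,x_n^N)`, as a power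
series over `ℤ`. -/
noncomputable def invHilb {F : Type} [Field F] {n : ℕ} (G : Subgroup (GL (Fin n) F))
    (N : ℕ) : PowerSeries ℤ :=
  PowerSeries.mk fun d => (invPieceDim G N d : ℤ)

section FrobeniusPower

variable {F : Type} [Field F] {n : ℕ}

theorem mem_frobIdeal_iff {N : ℕ} {f : MvPolynomial (Fin n) F} :
    f ∈ frobIdeal F n N ↔ ∀ a ∈ f.support, ∃ i, N ≤ a i := by
  have h : (Set.range fun i : Fin n => (X i : MvPolynomial (Fin n) F) ^ N)
      = (fun s => monomial s (1 : F)) '' Set.range fun i : Fin n => Finsupp.single i N := by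
    rw [← Set.range_comp]
    congr 1
    funext i
    simp [X_pow_eq_monomial]
  rw [frobIdeal, h, mem_ideal_span_monomial_image]
  simp

theorem mem_frobIdeal_iff_coeff {N : ℕ} {f : MvPolynomial (Fin n) F} :
    f ∈ frobIdeal F n N ↔ ∀ a : Fin n →₀ ℕ, (∀ i, a i < N) → coeff a f = 0 := by
  rw [mem_frobIdeal_iff]
  refine forall_congr' fun a => ?_
  rw [mem_support_iff, ← not_imp_not]
  simp

theorem frobIdeal_of_X_pow_dvd {N j : ℕ} (hj : N ≤ j) (k : Fin n) {f : MvPolynomial (Fin n) F}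
    (h : X k ^ j ∣ f) : f ∈ frobIdeal F n N :=
  Ideal.mem_of_dvd _ ((pow_dvd_pow _ hj).trans h) (Ideal.subset_span ⟨k, rfl⟩)

theorem coeff_eq_zero_of_X_pow_dvd {k : Fin n} {j : ℕ} {f : MvPolynomial (Fin n) F}
    (h : X k ^ j ∣ f) {a : Fin n →₀ ℕ} (ha : a k < j) : coeff a f = 0 := by
  obtain ⟨g, rfl⟩ := h
  rw [X_pow_eq_monomial, coeff_monomial_mul', if_neg]
  intro hle
  have := hle k
  simp at this
  omega

/-- The exponents of the monomials that survive modulo `(x_1^N, …, x_n^N)`. -/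
noncomputable def exponentBox (n N : ℕ) : Finset (Fin n →₀ ℕ) :=
  (Fintype.piFinset fun _ : Fin n => Finset.range N).map
    Finsupp.equivFunOnFinite.symm.toEmbedding

theorem mem_exponentBox {N : ℕ} {a : Fin n →₀ ℕ} : a ∈ exponentBox n N ↔ ∀ i, a i < N := by
  simp only [exponentBox, Finset.mem_map_equiv, Fintype.mem_piFinset, Finset.mem_range,
    Equiv.symm_symm, Finsupp.equivFunOnFinite_apply]

variable {k : Fin n} {B : (Fin n →₀ ℕ) → MvPolynomial (Fin n) F}

theorem coeff_triangular (hB : ∀ a, X k ^ (a k + 1) ∣ B a - monomial a 1)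
    {a b : Fin n →₀ ℕ} (h : a k ≤ b k) :
    coeff a (B b) = if b = a then 1 else 0 := by
  have := coeff_eq_zero_of_X_pow_dvd (hB b) (Nat.lt_succ_of_le h)
  rw [coeff_sub, sub_eq_zero] at this
  rw [this, coeff_monomial]

theorem triangular_independent (hB : ∀ a, X k ^ (a k + 1) ∣ B a - monomial a 1)
    {N : ℕ} {c : (Fin n →₀ ℕ) → F}
    (h : ∑ a ∈ exponentBox n N, c a • B a ∈ frobIdeal F n N) :
    ∀ a ∈ exponentBox n N, c a = 0 := by
  classical
  by_contra! hc
  obtain ⟨a₀, ha₀, hca₀⟩ := hc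
  obtain ⟨a, ha, hmin⟩ := Finset.exists_min_image
    ((exponentBox n N).filter fun a => c a ≠ 0) (fun a => a k) ⟨a₀, by simp [ha₀, hca₀]⟩
  rw [Finset.mem_filter] at ha
  have h0 := mem_frobIdeal_iff_coeff.1 h a (mem_exponentBox.1 ha.1)
  rw [coeff_sum, Finset.sum_eq_single a] at h0
  · rw [coeff_smul, coeff_triangular hB le_rfl, if_pos rfl, smul_eq_mul, mul_one] at h0
    exact ha.2 h0
  · intro b hb hba
    by_cases hcb : c b = 0
    · simp [hcb]
    · rw [coeff_smul, coeff_triangular hB (hmin b (by simp [hb, hcb])), if_neg hba, smul_zero]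
  · exact fun h => (h ha.1).elim

theorem triangular_spanning (hB : ∀ a, X k ^ (a k + 1) ∣ B a - monomial a 1)
    (N : ℕ) (f : MvPolynomial (Fin n) F) :
    ∃ c : (Fin n →₀ ℕ) → F, f - ∑ a ∈ exponentBox n N, c a • B a ∈ frobIdeal F n N := by
  let W : Submodule F (MvPolynomial (Fin n) F) :=
    Submodule.span F (B '' exponentBox n N) ⊔ (frobIdeal F n N).restrictScalars F
  suffices hW : ∀ d j, N ≤ j + d → ∀ f : MvPolynomial (Fin n) F, X k ^ j * f ∈ W by
    have := hW N 0 (by omega) f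
    rw [pow_zero, one_mul, Submodule.mem_sup] at this
    obtain ⟨y, hy, z, hz, rfl⟩ := this
    obtain ⟨c, rfl⟩ := (Submodule.mem_span_image_finset_iff_exists_fun F).1 hy
    refine ⟨fun a => if h : a ∈ exponentBox n N then c ⟨a, h⟩ else 0, ?_⟩
    rw [← Finset.sum_coe_sort (exponentBox n N) fun a =>
      (if h : a ∈ exponentBox n N then c ⟨a, h⟩ else 0) • B a]
    simpa using hz
  intro d
  induction d with
  | zero =>
    intro j hj f
    exact Submodule.mem_sup_right (frobIdeal_of_X_pow_dvd (by omega) k (dvd_mul_right _ f))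
  | succ d ih =>
    intro j hj f
    induction f using MvPolynomial.induction_on' with
    | add f g hf hg => rw [mul_add]; exact W.add_mem hf hg
    | monomial c r =>
      have hm : X k ^ j * monomial c r = r • monomial (Finsupp.single k j + c) (1 : F) := by
        rw [X_pow_eq_monomial, monomial_mul, smul_monomial, one_mul, smul_eq_mul, mul_one]
      rw [hm]
      refine W.smul_mem _ ?_
      set a := Finsupp.single k j + c with ha
      have hak : j ≤ a k := by simp [ha]
      obtain ⟨h, hh⟩ := hB a
      rw [← sub_sub_cancel (B a) (monomial a 1), hh]
      by_cases hbox : a ∈ exponentBox n N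
      · refine W.sub_mem (Submodule.mem_sup_left (Submodule.subset_span ⟨a, hbox, rfl⟩)) ?_
        rw [show a k + 1 = (j + 1) + (a k - j) by omega, pow_add, mul_assoc]
        exact ih (j + 1) (by omega) _
      · rw [← hh, sub_sub_cancel]
        refine Submodule.mem_sup_right (mem_frobIdeal_iff_coeff.2 fun b hb => ?_)
        rw [coeff_monomial, if_neg]
        rintro rfl
        exact hbox (mem_exponentBox.2 hb)

theorem homogeneousComponent_mem_frobIdeal {N d : ℕ} {f : MvPolynomial (Fin n) F}
    (hf : f ∈ frobIdeal F n N) : homogeneousComponent d f ∈ frobIdeal F n N := by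
  rw [mem_frobIdeal_iff_coeff] at *
  intro a ha
  rw [coeff_homogeneousComponent, hf a ha, ite_self]

end FrobeniusPower

section Shear

variable {F : Type} [Field F] {n : ℕ}

/-- The substitution `x_i ↦ x_i + β_i x_k`. -/
noncomputable def shear (k : Fin n) (β : Fin n → F) :
    MvPolynomial (Fin n) F →ₐ[F] MvPolynomial (Fin n) F :=
  aeval fun i => X i + C (β i) * X k

@[simp]
theorem shear_X (k : Fin n) (β : Fin n → F) (i : Fin n) :
    shear k β (X i) = X i + C (β i) * X k := by
  simp [shear]

theorem X_dvd_shear_sub (k : Fin n) (β : Fin n → F) (f : MvPolynomial (Fin n) F) :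
    X k ∣ shear k β f - f := by
  rw [← Ideal.mem_span_singleton, ← Ideal.Quotient.mk_eq_mk_iff_sub_mem]
  have h : (Ideal.Quotient.mkₐ F (Ideal.span {(X k : MvPolynomial (Fin n) F)})).comp (shear k β)
      = Ideal.Quotient.mkₐ F (Ideal.span {(X k : MvPolynomial (Fin n) F)}) := by
    ext i
    simp only [AlgHom.comp_apply, shear_X, Ideal.Quotient.mkₐ_eq_mk,
      Ideal.Quotient.mk_eq_mk_iff_sub_mem, add_sub_cancel_left]
    exact Ideal.mul_mem_left _ _ (Ideal.mem_span_singleton_self _)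
  exact DFunLike.congr_fun h f

theorem shear_X_self (k : Fin n) (β : Fin n → F) :
    shear k β (X k) = C (1 + β k) * X k := by
  rw [shear_X, C_add, C_1]; ring

theorem shear_single_X_pow_mul {k i : Fin n} (hik : i ≠ k) (j : ℕ)
    (f : MvPolynomial (Fin n) F) :
    shear k (Pi.single i 1) (X k ^ j * f) = X k ^ j * shear k (Pi.single i 1) f := by
  rw [map_mul, map_pow, shear_X_self, Pi.single_eq_of_ne hik.symm]
  simp

theorem X_pow_dvd_shear_single_monomial {k i : Fin n} (hik : i ≠ k) (a : Fin n →₀ ℕ) :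
    X k ^ (a k + 2) ∣ shear k (Pi.single i (1 : F)) (monomial a 1) - monomial a 1
      - (a i : F) • monomial (a - Finsupp.single i 1 + Finsupp.single k 1) 1 := by
  classical
  set b := (a.erase i).erase k with hb
  have ha : a = Finsupp.single k (a k) + (Finsupp.single i (a i) + b) := by
    ext j
    rcases eq_or_ne j i with rfl | hji
    · simp [hb, hik]
    · rcases eq_or_ne j k with rfl | hjk
      · simp [hb, hik]
      · simp [hb, hji, hjk]
  have ha' : a i = 0 ∨ a - Finsupp.single i 1 + Finsupp.single k 1
      = Finsupp.single k (a k + 1) + (Finsupp.single i (a i - 1) + b) := by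
    by_cases h0 : a i = 0
    · exact Or.inl h0
    right
    ext j
    rcases eq_or_ne j i with rfl | hji
    · simp [hb, hik]
    · rcases eq_or_ne j k with rfl | hjk
      · simp [hb, hik]
      · simp [hb, hji, hjk]
  have hfix : shear k (Pi.single i (1 : F)) (monomial b 1) = monomial b 1 := by
    rw [monomial_eq, C_1, one_mul, Finsupp.prod, map_prod]
    refine Finset.prod_congr rfl fun j hj => ?_
    have hji : j ≠ i := by
      rintro rfl
      simp [hb, hik] at hj
    rw [map_pow, shear_X, Pi.single_eq_of_ne hji]
    simp
  have hm : (monomial a (1 : F)) = X k ^ a k * (X i ^ a i * monomial b 1) := by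
    conv_lhs => rw [ha]
    simp [X_pow_eq_monomial]
  obtain ⟨h, hh⟩ := Polynomial.powAddExpansion (X i : MvPolynomial (Fin n) F) (X k) (a i)
  have hσ : shear k (Pi.single i (1 : F)) (X i) = X i + X k := by simp
  have hd : (a i : F) • monomial (a - Finsupp.single i 1 + Finsupp.single k 1) (1 : F)
      = X k ^ a k * ((a i : MvPolynomial (Fin n) F) * X i ^ (a i - 1) * X k * monomial b 1) := by
    rcases ha' with h0 | h1
    · simp [h0]
    · rw [h1, smul_eq_C_mul, map_natCast]
      have : monomial (Finsupp.single k (a k + 1) + (Finsupp.single i (a i - 1) + b)) (1 : F)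
        = X k ^ (a k + 1) * (X i ^ (a i - 1) * monomial b 1) := by simp [X_pow_eq_monomial]
      rw [this]
      ring
  rw [hd, hm, shear_single_X_pow_mul hik, map_mul, map_pow, hσ, hfix, hh]
  exact ⟨h * monomial b 1, by ring⟩

theorem X_pow_dvd_shear_single {k i : Fin n} (hik : i ≠ k) {f : MvPolynomial (Fin n) F}
    {a : Fin n →₀ ℕ} (hf : X k ^ (a k + 1) ∣ f - monomial a 1) :
    X k ^ (a k + 2) ∣ shear k (Pi.single i (1 : F)) f - f
      - (a i : F) • monomial (a - Finsupp.single i 1 + Finsupp.single k 1) 1 := by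
  obtain ⟨h, hh⟩ := hf
  obtain ⟨h', hh'⟩ := X_dvd_shear_sub k (Pi.single i (1 : F)) h
  rw [sub_eq_iff_eq_add] at hh
  have key : shear k (Pi.single i (1 : F)) f - f
      - (a i : F) • monomial (a - Finsupp.single i 1 + Finsupp.single k 1) 1
      = (shear k (Pi.single i (1 : F)) (monomial a 1) - monomial a 1
      - (a i : F) • monomial (a - Finsupp.single i 1 + Finsupp.single k 1) 1)
      + X k ^ (a k + 2) * h' := by
    rw [hh, map_add, shear_single_X_pow_mul hik, pow_succ _ (a k + 1), mul_assoc _ _ h', ← hh']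
    ring
  rw [key]
  exact dvd_add (X_pow_dvd_shear_single_monomial hik a) (dvd_mul_right _ _)

end Shear

section AdaptedMonomial

variable {p : ℕ} [Fact p.Prime] {n : ℕ}

/-- The monomial `x^a` in which, for `i ∈ T`, every full `p`-th power `x_i ^ p` is replaced by the
orbit product `x_i ^ p - x_k ^ (p - 1) x_i` of `x_i` under `x_i ↦ x_i + c x_k`. -/
noncomputable def adaptedMonomial (p : ℕ) {n : ℕ} (T : Finset (Fin n)) (k : Fin n)
    (a : Fin n →₀ ℕ) : MvPolynomial (Fin n) (ZMod p) :=
  ∏ i, if i ∈ T then X i ^ (a i % p) * (X i ^ p - X k ^ (p - 1) * X i) ^ (a i / p)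
    else X i ^ a i

theorem X_pow_dvd_adaptedMonomial_sub {T : Finset (Fin n)} {k : Fin n} (hk : k ∉ T)
    (a : Fin n →₀ ℕ) : X k ^ (a k + 1) ∣ adaptedMonomial p T k a - monomial a 1 := by
  have hm : monomial a (1 : ZMod p) = ∏ i, X i ^ a i := by
    rw [monomial_eq, C_1, one_mul, Finsupp.prod_fintype _ _ (by simp)]
  rw [hm, adaptedMonomial, ← Finset.mul_prod_erase _ _ (Finset.mem_univ k), if_neg hk,
    ← Finset.mul_prod_erase _ (fun i => X i ^ a i) (Finset.mem_univ k), ← mul_sub, pow_succ]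
  refine mul_dvd_mul_left _ ?_
  rw [← Ideal.mem_span_singleton, ← Ideal.Quotient.mk_eq_mk_iff_sub_mem, map_prod, map_prod]
  refine Finset.prod_congr rfl fun i _ => ?_
  split_ifs
  · have h0 : Ideal.Quotient.mk (Ideal.span {(X k : MvPolynomial (Fin n) (ZMod p))}) (X k) = 0 :=
      Ideal.Quotient.eq_zero_iff_mem.2 (Ideal.mem_span_singleton_self _)
    have hp : p - 1 ≠ 0 := by have := (Fact.out : p.Prime).two_le; omega
    rw [map_mul, map_pow, map_pow, map_sub, map_mul, map_pow, map_pow, h0, zero_pow hp, zero_mul,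
      sub_zero, ← pow_mul, ← pow_add, Nat.mod_add_div, map_pow]
  · rfl

theorem isHomogeneous_adaptedMonomial (T : Finset (Fin n)) (k : Fin n) (a : Fin n →₀ ℕ) :
    (adaptedMonomial p T k a).IsHomogeneous (∑ i, a i) := by
  have hp := (Fact.out : p.Prime).one_le
  refine IsHomogeneous.prod _ _ _ fun i _ => ?_
  split_ifs
  · have h1 : ((X i : MvPolynomial (Fin n) (ZMod p)) ^ p - X k ^ (p - 1) * X i).IsHomogeneous p := by
      refine IsHomogeneous.sub (isHomogeneous_X_pow _ _) ?_
      have h2 := (isHomogeneous_X_pow (R := ZMod p) k (p - 1)).mul (isHomogeneous_X (ZMod p) i)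
      rwa [Nat.sub_add_cancel hp] at h2
    have h3 := (isHomogeneous_X_pow (R := ZMod p) i (a i % p)).mul (h1.pow (a i / p))
    rwa [Nat.mod_add_div] at h3
  · exact isHomogeneous_X_pow _ _

theorem shear_orbit_product {k : Fin n} {β : Fin n → ZMod p} (hβk : 1 + β k ≠ 0) (i : Fin n) :
    shear k β (X i ^ p - X k ^ (p - 1) * X i) = X i ^ p - X k ^ (p - 1) * X i := by
  have hp : p - 1 + 1 = p := by have := (Fact.out : p.Prime).two_le; omega
  rw [map_sub, map_mul, map_pow, map_pow, shear_X_self, shear_X, add_pow_char, mul_pow, mul_pow,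
    ← C_pow, ← C_pow, ZMod.pow_card, ZMod.pow_card_sub_one_eq_one hβk, C_1, one_mul, mul_add,
    ← mul_assoc _ (C (β i)), mul_comm _ (C (β i)), mul_assoc (C (β i)), ← pow_succ, hp]
  ring

theorem shear_adaptedMonomial {T : Finset (Fin n)} {k : Fin n} (hk : k ∉ T) {β : Fin n → ZMod p}
    (hβk : 1 + β k ≠ 0) (hβ : ∀ i, i ∉ T → i ≠ k → β i = 0) {a : Fin n →₀ ℕ}
    (ha : ∀ i ∈ T, β i = 0 ∨ p ∣ a i) :
    shear k β (adaptedMonomial p T k a) = C ((1 + β k) ^ a k) * adaptedMonomial p T k a := by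
  rw [adaptedMonomial, ← Finset.mul_prod_erase _ _ (Finset.mem_univ k), if_neg hk, map_mul,
    map_pow, shear_X_self, mul_pow, C_pow, mul_assoc, map_prod]
  congr 2
  refine Finset.prod_congr rfl fun i hi => ?_
  have hik := Finset.ne_of_mem_erase hi
  split_ifs with hiT
  · rw [map_mul, map_pow, map_pow, shear_orbit_product hβk]
    rcases ha i hiT with h | h
    · simp [h]
    · simp [Nat.mod_eq_zero_of_dvd h]
  · rw [map_pow, shear_X, hβ i hiT hik]
    simp

end AdaptedMonomial

section Invariants

variable {p : ℕ} [Fact p.Prime] {n : ℕ}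

theorem mem_invLift {F : Type} [Field F] {G : Subgroup (GL (Fin n) F)} {N : ℕ}
    {f : MvPolynomial (Fin n) F} :
    f ∈ invLift G N ↔ ∀ g ∈ G, gSub g f - f ∈ frobIdeal F n N := by
  simp [invLift, Submodule.mem_iInf]

theorem gSub_mem_frobIdeal {m : ℕ} (g : GL (Fin n) (ZMod p)) {f : MvPolynomial (Fin n) (ZMod p)}
    (hf : f ∈ frobIdeal (ZMod p) n (p ^ m)) : gSub g f ∈ frobIdeal (ZMod p) n (p ^ m) := by
  have h : frobIdeal (ZMod p) n (p ^ m) ≤ (frobIdeal (ZMod p) n (p ^ m)).comap (gSub g) := by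
    refine Ideal.span_le.2 ?_
    rintro _ ⟨i, rfl⟩
    rw [SetLike.mem_coe, Ideal.mem_comap, map_pow, gSub, aeval_X, sum_pow_char_pow]
    refine Ideal.sum_mem _ fun j _ => ?_
    rw [mul_pow]
    exact Ideal.mul_mem_left _ _ (Ideal.subset_span ⟨j, rfl⟩)
  exact h hf

theorem zmod_pow_prime_pow_sub_one {μ : ZMod p} (hμ : μ ≠ 0) (m : ℕ) : μ ^ (p ^ m - 1) = 1 := by
  have h := ZMod.pow_card_pow (n := m) μ
  have hq : 0 < p ^ m := pow_pos (Fact.out : p.Prime).pos m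
  rw [← Nat.sub_add_cancel hq, pow_succ] at h
  exact mul_right_cancel₀ hμ (h.trans (one_mul μ).symm)

theorem shear_adaptedMonomial_sub_mem_of_top {m : ℕ} {T : Finset (Fin n)} {k : Fin n} (hk : k ∉ T)
    {β : Fin n → ZMod p} (hβk : 1 + β k ≠ 0) {a : Fin n →₀ ℕ} (ha : a k = p ^ m - 1) :
    shear k β (adaptedMonomial p T k a) - adaptedMonomial p T k a
      ∈ frobIdeal (ZMod p) n (p ^ m) := by
  have hq : 0 < p ^ m := pow_pos (Fact.out : p.Prime).pos m
  obtain ⟨h, hh⟩ : X k ^ (p ^ m - 1) ∣ adaptedMonomial p T k a := by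
    rw [adaptedMonomial, ← Finset.mul_prod_erase _ _ (Finset.mem_univ k), if_neg hk, ha]
    exact dvd_mul_right _ _
  refine frobIdeal_of_X_pow_dvd le_rfl k ?_
  rw [hh, map_mul, map_pow, shear_X_self, mul_pow, ← C_pow, zmod_pow_prime_pow_sub_one hβk, C_1,
    one_mul, ← mul_sub]
  nth_rw 1 [← Nat.sub_add_cancel hq]
  rw [pow_succ]
  exact mul_dvd_mul_left _ (X_dvd_shear_sub k β h)

theorem prime_dvd_of_shear_single_invariant {m : ℕ} {T : Finset (Fin n)} {k i : Fin n}
    (hk : k ∉ T) (hi : i ∈ T) {c : (Fin n →₀ ℕ) → ZMod p}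
    (hinv : shear k (Pi.single i 1) (∑ a ∈ exponentBox n (p ^ m), c a • adaptedMonomial p T k a)
      - ∑ a ∈ exponentBox n (p ^ m), c a • adaptedMonomial p T k a ∈ frobIdeal (ZMod p) n (p ^ m))
    {a : Fin n →₀ ℕ} (ha : a ∈ exponentBox n (p ^ m)) (hca : c a ≠ 0) (hak : a k ≠ p ^ m - 1) :
    p ∣ a i := by
  classical
  have hik : i ≠ k := by rintro rfl; exact hk hi
  by_contra hpa
  obtain ⟨b, hb, hmin⟩ := Finset.exists_min_image
    ((exponentBox n (p ^ m)).filter fun a => c a ≠ 0 ∧ a k ≠ p ^ m - 1 ∧ ¬ p ∣ a i)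
    (fun a => a k) ⟨a, by simp [ha, hca, hak, hpa]⟩
  obtain ⟨hbb, hcb, hbk, hpb⟩ := Finset.mem_filter.1 hb
  have hbox := mem_exponentBox.1 hbb
  have hbi : b i ≠ 0 := fun h => hpb (h ▸ dvd_zero p)
  set b' := b - Finsupp.single i 1 + Finsupp.single k 1 with hb'
  have hb'k : b' k = b k + 1 := by simp [hb', hik]
  have hb'box : ∀ j, b' j < p ^ m := by
    intro j
    rcases eq_or_ne j k with rfl | hjk
    · have := hbox j; omega
    · have : b' j ≤ b j := by simp [hb', hjk]
      exact this.trans_lt (hbox j)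
  have h0 := (mem_frobIdeal_iff_coeff (F := ZMod p)).1 hinv b' hb'box
  rw [map_sum, ← Finset.sum_sub_distrib, coeff_sum, Finset.sum_eq_single b] at h0
  · have h1 := coeff_eq_zero_of_X_pow_dvd (F := ZMod p)
      (X_pow_dvd_shear_single (F := ZMod p) hik (X_pow_dvd_adaptedMonomial_sub hk b))
      (show b' k < b k + 2 by omega)
    rw [coeff_sub, sub_eq_zero, coeff_smul, coeff_monomial, if_pos rfl, smul_eq_mul,
      mul_one] at h1
    rw [map_smul, ← smul_sub, coeff_smul, h1, smul_eq_mul, mul_eq_zero] at h0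
    exact h0.elim hcb fun h => hpb ((ZMod.natCast_eq_zero_iff _ _).1 h)
  · intro d hd hdb
    rw [map_smul, ← smul_sub, coeff_smul, smul_eq_mul]
    by_cases hcd : c d = 0
    · rw [hcd, zero_mul]
    by_cases hdk : d k = p ^ m - 1
    · rw [(mem_frobIdeal_iff_coeff (F := ZMod p)).1 (shear_adaptedMonomial_sub_mem_of_top hk
        (by simp [Pi.single_eq_of_ne hik.symm]) hdk) b' hb'box, mul_zero]
    by_cases hpd : p ∣ d i
    · rw [shear_adaptedMonomial hk (by simp [Pi.single_eq_of_ne hik.symm]) _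
        (fun j _ => if hji : j = i then Or.inr (hji ▸ hpd) else
          Or.inl (Pi.single_eq_of_ne hji _)), Pi.single_eq_of_ne hik.symm]
      · simp
      · intro j hj _
        exact Pi.single_eq_of_ne (fun h : j = i => hj (h ▸ hi)) _
    · have hle := hmin d (by simp [hd, hcd, hdk, hpd])
      have h1 := coeff_eq_zero_of_X_pow_dvd (F := ZMod p)
        (X_pow_dvd_shear_single (F := ZMod p) hik (X_pow_dvd_adaptedMonomial_sub hk d))
        (show b' k < d k + 2 by omega)
      rw [coeff_sub, sub_eq_zero, coeff_smul, coeff_monomial, if_neg, smul_zero] at h1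
      · rw [h1, mul_zero]
      · intro h
        have hdi : d i ≠ 0 := fun h => hpd (h ▸ dvd_zero p)
        refine hdb (Finsupp.ext fun j => ?_)
        have := DFunLike.congr_fun h j
        rcases eq_or_ne j i with rfl | hji
        · simp [hb', hik] at this
          omega
        · simpa [hb', hji] using this
  · exact fun h => (h hbb).elim

theorem orderOf_dvd_of_shear_invariant {m : ℕ} {T : Finset (Fin n)} {k : Fin n}
    (hk : k ∉ T) {β : Fin n → ZMod p} (hβk : 1 + β k ≠ 0) (hβ : ∀ i, i ∉ T → i ≠ k → β i = 0)
    {c : (Fin n →₀ ℕ) → ZMod p}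
    (hinv : shear k β (∑ a ∈ exponentBox n (p ^ m), c a • adaptedMonomial p T k a)
      - ∑ a ∈ exponentBox n (p ^ m), c a • adaptedMonomial p T k a ∈ frobIdeal (ZMod p) n (p ^ m))
    (hc : ∀ a ∈ exponentBox n (p ^ m), c a ≠ 0 → a k ≠ p ^ m - 1 → ∀ i ∈ T, p ∣ a i)
    {a : Fin n →₀ ℕ} (ha : a ∈ exponentBox n (p ^ m)) (hca : c a ≠ 0) :
    orderOf (1 + β k) ∣ a k := by
  have hsum : ∑ a ∈ exponentBox n (p ^ m), (c a * ((1 + β k) ^ a k - 1)) • adaptedMonomial p T k a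
      ∈ frobIdeal (ZMod p) n (p ^ m) := by
    rw [← Submodule.sub_mem_iff_right _ hinv, map_sum, ← Finset.sum_sub_distrib,
      ← Finset.sum_sub_distrib]
    refine Ideal.sum_mem _ fun b hb => ?_
    by_cases hcb : c b = 0
    · simp [hcb]
    by_cases hbk : b k = p ^ m - 1
    · rw [map_smul, ← smul_sub, hbk, zmod_pow_prime_pow_sub_one hβk, sub_self, mul_zero, zero_smul,
        sub_zero, smul_eq_C_mul]
      exact Ideal.mul_mem_left _ _ (shear_adaptedMonomial_sub_mem_of_top hk hβk hbk)
    · rw [map_smul, shear_adaptedMonomial hk hβk hβ fun i hi => Or.inr (hc b hb hcb hbk i hi)]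
      convert Ideal.zero_mem _ using 1
      simp only [smul_eq_C_mul, C_mul, C_sub, C_1]
      ring
  have := triangular_independent (F := ZMod p) (X_pow_dvd_adaptedMonomial_sub hk) hsum a ha
  rw [mul_eq_zero, or_iff_right hca, sub_eq_zero] at this
  exact orderOf_dvd_of_pow_eq_one this

/-- The exponents of the adapted monomials spanning the invariants. -/
def IsInvariantExponent (p N e : ℕ) (T : Finset (Fin n)) (k : Fin n) (a : Fin n →₀ ℕ) : Prop :=
  a k = N - 1 ∨ e ∣ a k ∧ ∀ i ∈ T, p ∣ a i

open Classical in
theorem invPieceDim_eq_card {m e : ℕ} {T : Finset (Fin n)} {k : Fin n} (hk : k ∉ T)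
    {G : Subgroup (GL (Fin n) (ZMod p))}
    (hG : ∀ g ∈ G, ∃ β : Fin n → ZMod p, (∀ i, i ∉ T → i ≠ k → β i = 0) ∧ 1 + β k ≠ 0 ∧
      (1 + β k) ^ e = 1 ∧ gSub g = shear k β)
    (hT : ∀ i ∈ T, ∃ g ∈ G, gSub g = shear k (Pi.single i 1))
    (he : ∃ g ∈ G, ∃ β : Fin n → ZMod p, (∀ i, i ∉ T → i ≠ k → β i = 0) ∧ 1 + β k ≠ 0 ∧
      orderOf (1 + β k) = e ∧ gSub g = shear k β) (d : ℕ) :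
    invPieceDim G (p ^ m) d = (((exponentBox n (p ^ m)).filter fun a =>
      IsInvariantExponent p (p ^ m) e T k a).filter fun a => ∑ i, a i = d).card := by
  set s := ((exponentBox n (p ^ m)).filter fun a =>
      IsInvariantExponent p (p ^ m) e T k a).filter fun a => ∑ i, a i = d with hs
  have hsbox : s ⊆ exponentBox n (p ^ m) :=
    (Finset.filter_subset _ _).trans (Finset.filter_subset _ _)
  let π := (Ideal.Quotient.mkₐ (ZMod p) (frobIdeal (ZMod p) n (p ^ m))).toLinearMap
  have hπ : ∀ f, π f = 0 ↔ f ∈ frobIdeal (ZMod p) n (p ^ m) := fun f =>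
    Ideal.Quotient.eq_zero_iff_mem
  let v : (Fin n →₀ ℕ) → _ := fun a => π (adaptedMonomial p T k a)
  have hv : LinearIndepOn (ZMod p) v (exponentBox n (p ^ m) : Set (Fin n →₀ ℕ)) := by
    rw [linearIndepOn_finset_iff]
    intro c hc
    refine triangular_independent (F := ZMod p) (X_pow_dvd_adaptedMonomial_sub hk) ?_
    rw [← hπ, map_sum]
    simpa only [map_smul] using hc
  have hvs : LinearIndepOn (ZMod p) v (s : Set (Fin n →₀ ℕ)) := hv.mono (by exact_mod_cast hsbox)
  have hspan : (homogeneousSubmodule (Fin n) (ZMod p) d ⊓ invLift G (p ^ m)).map π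
      = Submodule.span (ZMod p) (v '' s) := by
    refine le_antisymm ?_ ?_
    · rintro _ ⟨f, ⟨hfd, hf⟩, rfl⟩
      obtain ⟨c, hc⟩ := triangular_spanning (F := ZMod p) (X_pow_dvd_adaptedMonomial_sub hk) (p ^ m) f
      have hfd' : ∑ a ∈ exponentBox n (p ^ m), c a • adaptedMonomial p T k a
          - ∑ a ∈ exponentBox n (p ^ m), (if ∑ i, a i = d then c a else 0) • adaptedMonomial p T k a
          ∈ frobIdeal (ZMod p) n (p ^ m) := by
        have h1 := homogeneousComponent_mem_frobIdeal (d := d) hc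
        rw [map_sub, homogeneousComponent_of_mem hfd, if_pos rfl, map_sum] at h1
        have h2 := Ideal.sub_mem _ h1 hc
        rw [sub_sub_sub_cancel_left] at h2
        convert h2 using 3 with a
        rw [map_smul, homogeneousComponent_of_mem (isHomogeneous_adaptedMonomial T k a)]
        simp only [eq_comm (a := d)]
        split_ifs <;> simp
      have hcd : ∀ a ∈ exponentBox n (p ^ m), c a ≠ 0 → ∑ i, a i = d := by
        intro a ha hca
        rw [← Finset.sum_sub_distrib] at hfd'
        simp only [← sub_smul] at hfd'
        have := triangular_independent (F := ZMod p) (X_pow_dvd_adaptedMonomial_sub hk) hfd' a ha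
        by_contra hne
        rw [if_neg hne, sub_zero] at this
        exact hca this
      have hinv : ∀ g ∈ G, gSub g (∑ a ∈ exponentBox n (p ^ m), c a • adaptedMonomial p T k a)
          - ∑ a ∈ exponentBox n (p ^ m), c a • adaptedMonomial p T k a
          ∈ frobIdeal (ZMod p) n (p ^ m) := by
        intro g hg
        have h1 := Ideal.sub_mem _ (mem_invLift.1 hf g hg)
          (Ideal.sub_mem _ (gSub_mem_frobIdeal g hc) hc)
        rw [map_sub] at h1
        convert h1 using 1
        ring
      have hcT : ∀ a ∈ exponentBox n (p ^ m), c a ≠ 0 → a k ≠ p ^ m - 1 → ∀ i ∈ T, p ∣ a i := by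
        intro a ha hca hak i hi
        obtain ⟨g, hg, hgi⟩ := hT i hi
        exact prime_dvd_of_shear_single_invariant hk hi (hgi ▸ hinv g hg) ha hca hak
      obtain ⟨g, hg, β, hβ, hβk, rfl, hgβ⟩ := he
      have hce := fun a ha hca =>
        orderOf_dvd_of_shear_invariant hk hβk hβ (hgβ ▸ hinv g hg) hcT (a := a) ha hca
      have hπf : π f = ∑ a ∈ exponentBox n (p ^ m), c a • v a := by
        rw [← hπ, map_sub, sub_eq_zero] at hc
        simpa only [map_sum, map_smul] using hc
      rw [hπf]
      refine Submodule.sum_mem _ fun a ha => ?_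
      by_cases hca : c a = 0
      · rw [hca, zero_smul]; exact Submodule.zero_mem _
      refine Submodule.smul_mem _ _ (Submodule.subset_span ⟨a, ?_, rfl⟩)
      rw [hs, Finset.mem_coe, Finset.mem_filter, Finset.mem_filter]
      refine ⟨⟨ha, ?_⟩, hcd a ha hca⟩
      by_cases hak : a k = p ^ m - 1
      · exact Or.inl hak
      · exact Or.inr ⟨hce a ha hca, hcT a ha hca hak⟩
    · rw [Submodule.span_le]
      rintro _ ⟨a, ha, rfl⟩
      rw [hs, Finset.mem_coe, Finset.mem_filter, Finset.mem_filter] at ha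
      obtain ⟨⟨-, hgood⟩, hd⟩ := ha
      refine ⟨_, ⟨hd ▸ isHomogeneous_adaptedMonomial T k a, mem_invLift.2 fun g hg => ?_⟩, rfl⟩
      obtain ⟨β, hβ, hβk, hβe, hgβ⟩ := hG g hg
      rw [hgβ]
      rcases hgood with h | ⟨⟨r, hr⟩, h⟩
      · exact shear_adaptedMonomial_sub_mem_of_top hk hβk h
      · rw [shear_adaptedMonomial hk hβk hβ fun i hi => Or.inr (h i hi), hr, pow_mul, hβe, one_pow,
          C_1, one_mul, sub_self]
        exact Ideal.zero_mem _
  rw [invPieceDim, hspan, Set.image_eq_range]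
  exact (finrank_span_eq_card hvs).trans (Fintype.card_coe s)

end Invariants

section Counting

variable {n : ℕ}

theorem sum_filter_dvd_pow_mul {R : Type*} [CommRing R] (x : R) {e : ℕ} (he : 0 < e) (K : ℕ) :
    (∑ j ∈ (Finset.range (e * K)).filter (e ∣ ·), x ^ j) * (1 - x ^ e) = 1 - x ^ (e * K) := by
  have h : (Finset.range (e * K)).filter (e ∣ ·) = (Finset.range K).image (e * ·) := by
    ext j
    simp only [Finset.mem_filter, Finset.mem_range, Finset.mem_image]
    constructor
    · rintro ⟨hj, i, rfl⟩
      exact ⟨i, lt_of_mul_lt_mul_left hj e.zero_le, rfl⟩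
    · rintro ⟨i, hi, rfl⟩
      exact ⟨mul_lt_mul_of_pos_left hi he, dvd_mul_right _ _⟩
  rw [h, Finset.sum_image fun a _ b _ hab => Nat.eq_of_mul_eq_mul_left he hab]
  simp only [pow_mul]
  exact geom_sum_mul_neg _ _

open Classical in
theorem mk_card_filter_degree (s : Finset (Fin n →₀ ℕ)) :
    (PowerSeries.mk fun d => (((s.filter fun a => ∑ i, a i = d).card : ℕ) : ℤ))
      = ∑ a ∈ s, (PowerSeries.X : PowerSeries ℤ) ^ ∑ i, a i := by
  ext d
  rw [PowerSeries.coeff_mk, map_sum, Finset.card_filter]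
  push_cast
  refine Finset.sum_congr rfl fun a _ => ?_
  rw [PowerSeries.coeff_X_pow]
  simp only [eq_comm]

open Classical in
theorem sum_isInvariantExponent {R : Type*} [CommRing R] (x : R) {p N e : ℕ} (hN : 0 < N)
    {T : Finset (Fin n)} {k : Fin n} (hk : k ∉ T) :
    ∑ a ∈ (exponentBox n N).filter fun a => IsInvariantExponent p N e T k a, x ^ ∑ i, a i
      = x ^ (N - 1) * (∑ j ∈ Finset.range N, x ^ j) ^ (n - 1)
        + (∑ j ∈ (Finset.range (N - 1)).filter (e ∣ ·), x ^ j)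
          * ((∑ j ∈ (Finset.range N).filter (p ∣ ·), x ^ j) ^ T.card
          * (∑ j ∈ Finset.range N, x ^ j) ^ (n - 1 - T.card)) := by
  let t₁ : Fin n → Finset ℕ := fun i => if i = k then {N - 1} else Finset.range N
  let t₂ : Fin n → Finset ℕ := fun i => if i = k then (Finset.range (N - 1)).filter (e ∣ ·) else
    if i ∈ T then (Finset.range N).filter (p ∣ ·) else Finset.range N
  have hset : (exponentBox n N).filter (fun a => IsInvariantExponent p N e T k a)
      = (Fintype.piFinset t₁ ∪ Fintype.piFinset t₂).map
        Finsupp.equivFunOnFinite.symm.toEmbedding := by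
    ext a
    rw [Finset.mem_filter, mem_exponentBox]
    simp only [IsInvariantExponent, Finset.mem_map_equiv,
      Finset.mem_union, Fintype.mem_piFinset, Equiv.symm_symm, Finsupp.equivFunOnFinite_apply]
    constructor
    · rintro ⟨hbox, h⟩
      by_cases hak : a k = N - 1
      · left
        intro i
        by_cases hi : i = k
        · simp [t₁, hi, hak]
        · simp [t₁, hi, hbox i]
      · right
        obtain ⟨h1, h2⟩ := h.resolve_left hak
        intro i
        by_cases hi : i = k
        · have := hbox k
          simp only [t₂, hi, if_true, Finset.mem_filter, Finset.mem_range]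
          exact ⟨by omega, h1⟩
        · by_cases hiT : i ∈ T
          · simp [t₂, hi, hiT, hbox i, h2 i hiT]
          · simp [t₂, hi, hiT, hbox i]
    · rintro (h | h)
      · have hk' : a k = N - 1 := by simpa [t₁] using h k
        refine ⟨fun i => ?_, Or.inl hk'⟩
        by_cases hi : i = k
        · rw [hi]; omega
        · simpa [t₁, hi] using h i
      · have hk' : a k < N - 1 ∧ e ∣ a k := by simpa [t₂] using h k
        refine ⟨fun i => ?_, Or.inr ⟨hk'.2, fun i hiT => ?_⟩⟩
        · by_cases hi : i = k
          · rw [hi]; omega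
          · by_cases hiT : i ∈ T
            · have : a i < N ∧ p ∣ a i := by simpa [t₂, hi, hiT] using h i
              exact this.1
            · simpa [t₂, hi, hiT] using h i
        · have hi : i ≠ k := by rintro rfl; exact hk hiT
          have : a i < N ∧ p ∣ a i := by simpa [t₂, hi, hiT] using h i
          exact this.2
  have hdisj : Disjoint (Fintype.piFinset t₁) (Fintype.piFinset t₂) := by
    rw [Finset.disjoint_left]
    intro a h1 h2
    have h1' : a k = N - 1 := by simpa [t₁] using Fintype.mem_piFinset.1 h1 k
    have h2' : a k < N - 1 ∧ e ∣ a k := by simpa [t₂] using Fintype.mem_piFinset.1 h2 k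
    omega
  have hprod : ∀ t : Fin n → Finset ℕ,
      ∑ a ∈ Fintype.piFinset t, x ^ ∑ i, Finsupp.equivFunOnFinite.symm a i
        = ∏ i, ∑ j ∈ t i, x ^ j := by
    intro t
    rw [Finset.prod_univ_sum]
    simp [Finset.prod_pow_eq_pow_sum]
  rw [hset, Finset.sum_map, Finset.sum_union hdisj]
  simp only [Equiv.coe_toEmbedding]
  rw [hprod, hprod, ← Finset.mul_prod_erase _ _ (Finset.mem_univ k),
    ← Finset.mul_prod_erase Finset.univ (fun i => ∑ j ∈ t₂ i, x ^ j) (Finset.mem_univ k)]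
  have hcard : (Finset.univ.erase k).card = n - 1 := by simp
  have hTsub : T ⊆ Finset.univ.erase k := fun i hi =>
    Finset.mem_erase.2 ⟨fun h => hk (h ▸ hi), Finset.mem_univ _⟩
  congr 1
  · rw [Finset.prod_congr rfl (g := fun _ => ∑ j ∈ Finset.range N, x ^ j), Finset.prod_const, hcard]
    · simp [t₁]
    · intro i hi
      simp [t₁, Finset.ne_of_mem_erase hi]
  · rw [← Finset.prod_sdiff hTsub, mul_comm (∏ i ∈ _, _) (∏ i ∈ T, _),
      Finset.prod_congr (s₁ := T) rfl (g := fun _ => ∑ j ∈ (Finset.range N).filter (p ∣ ·), x ^ j),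
      Finset.prod_congr (s₁ := Finset.univ.erase k \ T) rfl
        (g := fun _ => ∑ j ∈ Finset.range N, x ^ j),
      Finset.prod_const, Finset.prod_const, Finset.card_sdiff_of_subset hTsub, hcard]
    · simp [t₂]
    · intro i hi
      rw [Finset.mem_sdiff] at hi
      simp [t₂, Finset.ne_of_mem_erase hi.1, hi.2]
    · intro i hi
      simp [t₂, Finset.ne_of_mem_erase (hTsub hi), hi]

theorem sum_isInvariantExponent_mul {R : Type*} [CommRing R] {x A P E : R} {n ℓ p N e : ℕ}
    (hℓ : ℓ ≤ n - 1) (hA : A * (1 - x) = 1 - x ^ N) (hP : P * (1 - x ^ p) = 1 - x ^ N)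
    (hE : E * (1 - x ^ e) = 1 - x ^ (N - 1)) :
    (x ^ (N - 1) * A ^ (n - 1) + E * (P ^ ℓ * A ^ (n - 1 - ℓ))) * (1 - x) ^ (n - ℓ - 1)
        * (1 - x ^ p) ^ ℓ * (1 - x ^ e) * (1 - x) ^ ℓ
      = (1 - x ^ N) ^ (n - 1) * ((1 - x ^ (N - 1)) * (1 - x) ^ ℓ
        + x ^ (N - 1) * (1 - x ^ e) * (1 - x ^ p) ^ ℓ) := by
  obtain ⟨r, hr⟩ := Nat.exists_eq_add_of_le hℓ
  have h1 : n - 1 - ℓ = r := by omega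
  have h2 : n - ℓ - 1 = r := by omega
  rw [h1, h2, hr]
  calc _ = x ^ (N - 1) * (A * (1 - x)) ^ (ℓ + r) * (1 - x ^ p) ^ ℓ * (1 - x ^ e)
        + E * (1 - x ^ e) * (P * (1 - x ^ p)) ^ ℓ * (A * (1 - x)) ^ r * (1 - x) ^ ℓ := by
        rw [mul_pow, mul_pow, mul_pow, pow_add, pow_add]; ring
    _ = _ := by rw [hA, hP, hE, pow_add]; ring

end Counting

section Conjugation

variable {F : Type} [Field F] {n : ℕ}

theorem gSub_gSub (g h : GL (Fin n) F) (f : MvPolynomial (Fin n) F) :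
    gSub g (gSub h f) = gSub (h * g) f := by
  rw [← AlgHom.comp_apply]
  congr 1
  ext i
  simp only [gSub, AlgHom.comp_apply, aeval_X, map_sum, map_mul, algHom_C, Units.val_mul,
    Matrix.mul_apply, Finset.mul_sum, Finset.sum_mul, algebraMap_eq]
  rw [Finset.sum_comm]
  simp only [mul_assoc]

theorem gSub_one (f : MvPolynomial (Fin n) F) : gSub 1 f = f := by
  have : gSub (1 : GL (Fin n) F) = AlgHom.id F _ := by
    ext i
    simp [gSub, Matrix.one_apply]
  rw [this, AlgHom.id_apply]

theorem isHomogeneous_gSub (g : GL (Fin n) F) {f : MvPolynomial (Fin n) F} {d : ℕ}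
    (hf : f.IsHomogeneous d) : (gSub g f).IsHomogeneous d := by
  rw [← one_mul d]
  refine hf.aeval _ fun i => IsHomogeneous.sum _ _ _ fun j _ => ?_
  rw [← zero_add 1]
  exact (isHomogeneous_C _ _).mul (isHomogeneous_X _ _)

/-- The substitution `gSub g` as an automorphism of the polynomial ring. -/
noncomputable def gSubEquiv (g : GL (Fin n) F) :
    MvPolynomial (Fin n) F ≃ₐ[F] MvPolynomial (Fin n) F :=
  AlgEquiv.ofAlgHom (gSub g) (gSub g⁻¹)
    (AlgHom.ext fun f => by rw [AlgHom.comp_apply, gSub_gSub, inv_mul_cancel, gSub_one]; rfl)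
    (AlgHom.ext fun f => by rw [AlgHom.comp_apply, gSub_gSub, mul_inv_cancel, gSub_one]; rfl)

variable {p : ℕ} [Fact p.Prime]

theorem invPieceDim_conj (P : GL (Fin n) (ZMod p)) (G : Subgroup (GL (Fin n) (ZMod p)))
    (m d : ℕ) :
    invPieceDim (G.map (MulAut.conj P⁻¹).toMonoidHom) (p ^ m) d = invPieceDim G (p ^ m) d := by
  have hI : frobIdeal (ZMod p) n (p ^ m)
      = (frobIdeal (ZMod p) n (p ^ m)).map (gSubEquiv P : _ →+* MvPolynomial (Fin n) (ZMod p)) := by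
    refine le_antisymm (fun f hf => ?_) (Ideal.map_le_iff_le_comap.2 fun f hf =>
      gSub_mem_frobIdeal P hf)
    have := Ideal.mem_map_of_mem (gSubEquiv P : _ →+* MvPolynomial (Fin n) (ZMod p))
      (gSub_mem_frobIdeal P⁻¹ hf)
    change gSub P (gSub P⁻¹ f) ∈ _ at this
    rwa [gSub_gSub, inv_mul_cancel, gSub_one] at this
  let ψ := Ideal.quotientEquivAlg _ _ (gSubEquiv P) hI
  have hV : homogeneousSubmodule (Fin n) (ZMod p) d ⊓
      invLift (G.map (MulAut.conj P⁻¹).toMonoidHom) (p ^ m)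
      = (homogeneousSubmodule (Fin n) (ZMod p) d ⊓ invLift G (p ^ m)).map
        (gSub P).toLinearMap := by
    refine le_antisymm ?_ ?_
    · rintro f ⟨hfd, hf⟩
      refine ⟨gSub P⁻¹ f, ⟨isHomogeneous_gSub _ hfd, mem_invLift.2 fun g hg => ?_⟩, ?_⟩
      · have := gSub_mem_frobIdeal P⁻¹
          (mem_invLift.1 hf _ (Subgroup.mem_map_of_mem (MulAut.conj P⁻¹).toMonoidHom hg))
        simpa [gSub_gSub, mul_assoc] using this
      · simp [gSub_gSub, gSub_one]
    · rintro _ ⟨f, ⟨hfd, hf⟩, rfl⟩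
      refine ⟨isHomogeneous_gSub _ hfd, mem_invLift.2 ?_⟩
      rintro _ ⟨g, hg, rfl⟩
      have := gSub_mem_frobIdeal P (mem_invLift.1 hf g hg)
      simpa [gSub_gSub, mul_assoc] using this
  rw [invPieceDim, invPieceDim, hV]
  refine Eq.trans ?_ (LinearEquiv.finrank_map_eq ψ.toLinearEquiv _)
  rw [← Submodule.map_comp, ← Submodule.map_comp]
  rfl

end Conjugation

section Coordinates

variable {F : Type} [Field F] {n : ℕ}

open Classical in
theorem exists_adapted_basis (l : (Fin n → F) →ₗ[F] F) {z : Fin n → F} (hz : l z = 1)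
    {s : Set (Fin n → F)} (hs : ∀ v ∈ s, l v = 0) :
    ∃ (b : Module.Basis (Fin n) F (Fin n → F)) (T : Finset (Fin n)) (k : Fin n),
      k ∉ T ∧ b k = z ∧ (∀ i, i ≠ k → l (b i) = 0) ∧ (∀ i ∈ T, b i ∈ s) ∧
      Submodule.span F (b '' T) = Submodule.span F s ∧
      T.card = Module.finrank F (Submodule.span F s) := by
  obtain ⟨c, hcs, hcspan, hc⟩ := exists_linearIndependent F s
  replace hc : LinearIndepOn F id c := hc
  have hcl : c ⊆ (LinearMap.ker l : Set (Fin n → F)) := fun v hv => hs v (hcs hv)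
  set D := hc.extend hcl with hD
  have hDl : D ⊆ (LinearMap.ker l : Set (Fin n → F)) := hc.extend_subset hcl
  have hcD : c ⊆ D := hc.subset_extend hcl
  have hDspan : (LinearMap.ker l : Set (Fin n → F)) ⊆ Submodule.span F D := by
    simpa using hc.subset_span_extend hcl
  have hzD : z ∉ Submodule.span F D := fun h => by
    have : z ∈ LinearMap.ker l := Submodule.span_le.2 hDl h
    rw [LinearMap.mem_ker, hz] at this
    exact one_ne_zero this
  have hind : LinearIndepOn F id (insert z D) :=
    (hc.linearIndepOn_extend hcl).insert (by simpa using hzD)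
  have htop : ⊤ ≤ Submodule.span F (Set.range fun x : (insert z D : Set (Fin n → F)) => id x.1) := by
    intro v _
    simp only [id, Subtype.range_coe]
    have hv : v - l v • z ∈ Submodule.span F D := hDspan (by simp [hz])
    rw [← sub_add_cancel v (l v • z)]
    exact Submodule.add_mem _ (Submodule.span_mono (Set.subset_insert _ _) hv)
      (Submodule.smul_mem _ _ (Submodule.subset_span (Set.mem_insert _ _)))
  let b₀ := Module.Basis.mk hind htop
  let ε : (insert z D : Set (Fin n → F)) ≃ Fin n :=
    b₀.indexEquiv (Pi.basisFun F (Fin n))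
  let b := b₀.reindex ε
  have hb : ∀ i, b i = ε.symm i := fun i => by simp [b, b₀]
  have hbT : b '' ((Finset.univ.filter fun i => b i ∈ c : Finset (Fin n)) : Set (Fin n)) = c := by
    ext v
    constructor
    · rintro ⟨i, hi, rfl⟩
      simpa using hi
    · intro hv
      have hvb : b (ε ⟨v, Set.mem_insert_of_mem _ (hcD hv)⟩) = v := by simp [hb]
      exact ⟨_, by simpa [hvb] using hv, hvb⟩
  have hcard : ∀ T : Finset (Fin n),
      Module.finrank F (Submodule.span F (b '' (T : Set (Fin n)))) = T.card := fun T => by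
    rw [Set.image_eq_range]
    exact (finrank_span_eq_card (b.linearIndependent.comp _ Subtype.val_injective)).trans
      (Fintype.card_coe T)
  refine ⟨b, Finset.univ.filter fun i => b i ∈ c, ε ⟨z, Set.mem_insert _ _⟩, ?_, ?_, ?_, ?_, ?_, ?_⟩
  · intro h
    have hz' : z ∈ c := by simpa [hb] using h
    exact hzD (Submodule.subset_span (hcD hz'))
  · simp [hb]
  · intro i hi
    rw [hb]
    rcases (ε.symm i).2 with h | h
    · exact absurd ((ε.symm_apply_eq).1 (Subtype.ext h)) hi
    · exact hDl h
  · intro i hi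
    exact hcs (Finset.mem_filter.1 hi).2
  · rw [hbT, hcspan]
  · rw [← hcspan, ← hcard, hbT]

/-- The invertible matrix whose columns are the vectors of a basis. -/
noncomputable def basisMatrix (b : Module.Basis (Fin n) F (Fin n → F)) : GL (Fin n) F :=
  ⟨(Pi.basisFun F (Fin n)).toMatrix b, b.toMatrix (Pi.basisFun F (Fin n)),
    Module.Basis.toMatrix_mul_toMatrix_flip _ _, Module.Basis.toMatrix_mul_toMatrix_flip _ _⟩

theorem basisMatrix_apply (b : Module.Basis (Fin n) F (Fin n → F)) (i j : Fin n) :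
    (basisMatrix b : Matrix (Fin n) (Fin n) F) i j = b j i := rfl

theorem gSub_eq_shear {g : GL (Fin n) F} {k : Fin n} {β : Fin n → F}
    (h : (g : Matrix (Fin n) (Fin n) F) = 1 + Matrix.of fun i j => if j = k then β i else 0) :
    gSub g = shear k β := by
  ext1 i
  rw [shear_X, gSub, aeval_X, h]
  simp [Matrix.one_apply, add_mul, Finset.sum_add_distrib, apply_ite C]

theorem gSub_conj_basisMatrix (b : Module.Basis (Fin n) F (Fin n → F)) {k : Fin n}
    {g : GL (Fin n) F}
    (hg : ∀ i, i ≠ k → Matrix.mulVec (g : Matrix (Fin n) (Fin n) F) (b i) = b i) :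
    gSub ((basisMatrix b)⁻¹ * g * basisMatrix b)
      = shear k (b.repr (Matrix.mulVec (g : Matrix (Fin n) (Fin n) F) (b k) - b k)) := by
  refine gSub_eq_shear ?_
  set β := b.repr (Matrix.mulVec (g : Matrix (Fin n) (Fin n) F) (b k) - b k) with hβ
  have h : (g : Matrix (Fin n) (Fin n) F) * (basisMatrix b : Matrix (Fin n) (Fin n) F)
      = (basisMatrix b : Matrix (Fin n) (Fin n) F)
        * (1 + Matrix.of fun i j => if j = k then β i else 0) := by
    ext i j
    have h1 : ((g : Matrix (Fin n) (Fin n) F) * (basisMatrix b : Matrix (Fin n) (Fin n) F)) i j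
        = Matrix.mulVec (g : Matrix (Fin n) (Fin n) F) (b j) i := rfl
    rw [h1, mul_add, mul_one, Matrix.add_apply, Matrix.mul_apply]
    simp only [basisMatrix_apply, Matrix.of_apply]
    by_cases hj : j = k
    · subst hj
      have h2 := congrFun (b.sum_repr (Matrix.mulVec (g : Matrix (Fin n) (Fin n) F) (b j) - b j)) i
      rw [← hβ] at h2
      simp only [Finset.sum_apply, Pi.smul_apply, Pi.sub_apply, smul_eq_mul] at h2
      simp only [if_true, mul_comm (b _ i), h2]
      ring
    · simp [hj, hg j hj]
  rw [Units.val_mul, Units.val_mul, mul_assoc, h, ← mul_assoc, ← Units.val_mul, inv_mul_cancel,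
    Units.val_one, one_mul]

end Coordinates

section HyperplaneFixing

variable {F : Type} [Field F] {n : ℕ} {l : (Fin n → F) →ₗ[F] F}

theorem mulVec_eq_add_smul {A : Matrix (Fin n) (Fin n) F} (hA : ∀ v, l v = 0 → A *ᵥ v = v)
    {z : Fin n → F} (hz : l z = 1) (v : Fin n → F) : A *ᵥ v = v + l v • (A *ᵥ z - z) := by
  have h := hA (v - l v • z) (by simp [hz])
  rw [Matrix.mulVec_sub, Matrix.mulVec_smul, sub_eq_iff_eq_add] at h
  rw [h, smul_sub]
  abel

theorem apply_mulVec {A : Matrix (Fin n) (Fin n) F} (hA : ∀ v, l v = 0 → A *ᵥ v = v)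
    {z : Fin n → F} (hz : l z = 1) (v : Fin n → F) : l (A *ᵥ v) = l (A *ᵥ z) * l v := by
  rw [mulVec_eq_add_smul hA hz v, map_add, map_smul, map_sub, hz, smul_eq_mul]
  ring

theorem eq_one_of_isSemisimple {A : Matrix (Fin n) (Fin n) F}
    (hA : ∀ v, l v = 0 → A *ᵥ v = v) {z : Fin n → F} (hz : l z = 1) (h1 : l (A *ᵥ z) = 1)
    (hss : Module.End.IsSemisimple (Matrix.toLin' A)) : A = 1 := by
  have h2 := (Module.End.isSemisimple_sub_algebraMap_iff (μ := (1 : F))).2 hss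
  rw [map_one] at h2
  have hnil : IsNilpotent (Matrix.toLin' A - 1) := by
    refine ⟨2, LinearMap.ext fun v => ?_⟩
    have h3 : ∀ v, (Matrix.toLin' A - 1) v = l v • (A *ᵥ z - z) := fun v => by
      rw [LinearMap.sub_apply, Matrix.toLin'_apply, mulVec_eq_add_smul hA hz v,
        Module.End.one_apply, add_sub_cancel_left]
    rw [pow_two, Module.End.mul_apply, h3, h3]
    simp [h1, hz]
  have h0 := Module.End.eq_zero_of_isNilpotent_isSemisimple hnil h2
  rw [sub_eq_zero] at h0
  exact Matrix.toLin'.injective (h0.trans Matrix.toLin'_one.symm)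

theorem exists_eigenvector {A : Matrix (Fin n) (Fin n) F}
    (hA : ∀ v, l v = 0 → A *ᵥ v = v) {u : Fin n → F} (hu : l u = 1) (h1 : l (A *ᵥ u) ≠ 1) :
    ∃ z, l z = 1 ∧ A *ᵥ z = l (A *ᵥ u) • z := by
  have h2 : l (A *ᵥ u) - 1 ≠ 0 := sub_ne_zero.2 h1
  refine ⟨(l (A *ᵥ u) - 1)⁻¹ • (A *ᵥ u - u), ?_, ?_⟩
  · rw [map_smul, map_sub, hu, smul_eq_mul, inv_mul_cancel₀ h2]
  · rw [Matrix.mulVec_smul, smul_comm]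
    congr 1
    rw [mulVec_eq_add_smul hA hu, map_sub, hu, sub_smul, one_smul]
    abel

theorem isSemisimple_of_eigenvector {A : Matrix (Fin n) (Fin n) F}
    (hA : ∀ v, l v = 0 → A *ᵥ v = v) {z : Fin n → F} (hz : l z = 1) {μ : F} (hμ : μ ≠ 1)
    (h : A *ᵥ z = μ • z) : Module.End.IsSemisimple (Matrix.toLin' A) := by
  refine Module.End.isSemisimple_of_squarefree_aeval_eq_zero
    (p := (Polynomial.X - Polynomial.C 1) * (Polynomial.X - Polynomial.C μ)) ?_ ?_
  · refine Polynomial.Separable.squarefree ?_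
    refine Polynomial.Separable.mul Polynomial.separable_X_sub_C Polynomial.separable_X_sub_C
      (Polynomial.isCoprime_X_sub_C_of_isUnit_sub ?_)
    exact (sub_ne_zero.2 hμ.symm).isUnit
  · refine LinearMap.ext fun v => ?_
    have h3 : ∀ v, Matrix.toLin' A v = v + l v • (μ • z - z) := fun v => by
      rw [Matrix.toLin'_apply, mulVec_eq_add_smul hA hz v, h]
    simp only [map_mul, map_sub, Polynomial.aeval_X, Polynomial.aeval_C, map_one,
      Module.End.mul_apply, LinearMap.sub_apply, h3, Module.End.one_apply, LinearMap.zero_apply,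
      Module.algebraMap_end_apply, map_add, map_smul, hz]
    ext i
    simp
    ring

theorem pow_mulVec_eigenvector {A : Matrix (Fin n) (Fin n) F} {z : Fin n → F} {μ : F}
    (h : A *ᵥ z = μ • z) (j : ℕ) : (A ^ j) *ᵥ z = μ ^ j • z := by
  induction j with
  | zero => simp
  | succ j ih => rw [pow_succ, ← Matrix.mulVec_mulVec, h, Matrix.mulVec_smul, ih, smul_smul, pow_succ']

theorem orderOf_eq_of_eigenvector {g : GL (Fin n) F}
    (hg : ∀ v, l v = 0 → (g : Matrix (Fin n) (Fin n) F) *ᵥ v = v) {z : Fin n → F} (hz : l z = 1)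
    {μ : F} (h : (g : Matrix (Fin n) (Fin n) F) *ᵥ z = μ • z) : orderOf g = orderOf μ := by
  refine orderOf_eq_orderOf_iff.2 fun j => ?_
  have hp := pow_mulVec_eigenvector h j
  have hfix : ∀ v, l v = 0 → ((g : Matrix (Fin n) (Fin n) F) ^ j) *ᵥ v = v := fun v hv => by
    have := pow_mulVec_eigenvector (μ := 1) ((hg v hv).trans (one_smul F v).symm) j
    simpa using this
  rw [← Units.val_inj, Units.val_pow_eq_pow_val, Units.val_one]
  constructor
  · intro h1
    rw [h1, Matrix.one_mulVec] at hp
    have := congrArg l hp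
    rw [map_smul, hz, smul_eq_mul, mul_one] at this
    exact this.symm
  · intro h1
    refine Matrix.toLin'.injective (LinearMap.ext fun v => ?_)
    rw [Matrix.toLin'_apply, mulVec_eq_add_smul hfix hz v, hp, h1]
    simp

end HyperplaneFixing

section Character

variable {F : Type} [Field F] {n : ℕ} {l : (Fin n → F) →ₗ[F] F}

/-- The character by which a group fixing the hyperplane `ker l` pointwise acts on the quotient
by that hyperplane. -/
noncomputable def hyperplaneCharacter (G : Subgroup (GL (Fin n) F))
    (hfix : ∀ g ∈ G, ∀ v, l v = 0 → (g : Matrix (Fin n) (Fin n) F) *ᵥ v = v)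
    {u : Fin n → F} (hu : l u = 1) : G →* Fˣ :=
  MonoidHom.toHomUnits
    { toFun := fun g => l ((g : GL (Fin n) F).val *ᵥ u)
      map_one' := by simp [hu]
      map_mul' := fun g h => by
        rw [Subgroup.coe_mul, Units.val_mul, ← Matrix.mulVec_mulVec,
          apply_mulVec (hfix g g.2) hu] }

theorem hyperplaneCharacter_apply (G : Subgroup (GL (Fin n) F))
    (hfix : ∀ g ∈ G, ∀ v, l v = 0 → (g : Matrix (Fin n) (Fin n) F) *ᵥ v = v)
    {u : Fin n → F} (hu : l u = 1) (g : G) (v : Fin n → F) :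
    l ((g : GL (Fin n) F).val *ᵥ v) = hyperplaneCharacter G hfix hu g * l v :=
  apply_mulVec (hfix g g.2) hu v

/-- A complement of the hyperplane that is an eigenline for an element whose eigenvalue generates
the image of the character. -/
theorem exists_generating_eigenvector [Finite F] (G : Subgroup (GL (Fin n) F))
    (hfix : ∀ g ∈ G, ∀ v, l v = 0 → (g : Matrix (Fin n) (Fin n) F) *ᵥ v = v)
    {u : Fin n → F} (hu : l u = 1) :
    ∃ z, l z = 1 ∧ ∃ g₀ : G,
      (g₀ : GL (Fin n) F).val *ᵥ z = (hyperplaneCharacter G hfix hu g₀ : F) • z ∧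
      ∀ g : G, ∃ j : ℕ, hyperplaneCharacter G hfix hu g = hyperplaneCharacter G hfix hu g₀ ^ j := by
  set χ := hyperplaneCharacter G hfix hu with hχ
  obtain ⟨⟨_, g₀, rfl⟩, hgen⟩ := IsCyclic.exists_monoid_generator (α := χ.range)
  have hgen' : ∀ g : G, ∃ j : ℕ, χ g = χ g₀ ^ j := fun g => by
    obtain ⟨j, hj⟩ := (Submonoid.mem_powers_iff _ _).1 (hgen ⟨χ g, g, rfl⟩)
    exact ⟨j, (congrArg Subtype.val hj).symm⟩
  by_cases h1 : χ g₀ = 1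
  · exact ⟨u, hu, 1, by simp, by simpa [h1] using hgen'⟩
  · have h2 := hyperplaneCharacter_apply G hfix hu g₀ u
    rw [hu, mul_one] at h2
    obtain ⟨z, hz, hgz⟩ := exists_eigenvector (hfix g₀ g₀.2) hu
      (h2 ▸ fun h => h1 (Units.ext h))
    exact ⟨z, hz, g₀, h2 ▸ hgz, hgen'⟩

theorem orderOf_hyperplaneCharacter_eq [Finite F] {G : Subgroup (GL (Fin n) F)}
    {hfix : ∀ g ∈ G, ∀ v, l v = 0 → (g : Matrix (Fin n) (Fin n) F) *ᵥ v = v}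
    {u z : Fin n → F} {hu : l u = 1} (hz : l z = 1) {g₀ : G}
    (hg₀ : (g₀ : GL (Fin n) F).val *ᵥ z = (hyperplaneCharacter G hfix hu g₀ : F) • z)
    (hgen : ∀ g : G, ∃ j : ℕ,
      hyperplaneCharacter G hfix hu g = hyperplaneCharacter G hfix hu g₀ ^ j) {e : ℕ}
    (he : IsGreatest {k | ∃ g ∈ G, Module.End.IsSemisimple
      (Matrix.toLin' (g : Matrix (Fin n) (Fin n) F)) ∧ orderOf g = k} e) :
    orderOf (hyperplaneCharacter G hfix hu g₀) = e := by
  set χ := hyperplaneCharacter G hfix hu with hχ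
  refine le_antisymm ?_ ?_
  · by_cases h1 : χ g₀ = 1
    · rw [h1, orderOf_one]
      refine he.2 ⟨1, G.one_mem, ?_, orderOf_one⟩
      rw [Units.val_one, Matrix.toLin'_one]
      exact Module.End.isSemisimple_id
    · refine he.2 ⟨g₀, g₀.2, isSemisimple_of_eigenvector (hfix g₀ g₀.2) hz
        (fun h => h1 (Units.ext h)) hg₀, ?_⟩
      rw [orderOf_eq_of_eigenvector (hfix g₀ g₀.2) hz hg₀, orderOf_units]
  · obtain ⟨g, hg, hss, rfl⟩ := he.1
    refine Nat.le_of_dvd (orderOf_pos _) ?_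
    have h2 := hyperplaneCharacter_apply G hfix hu ⟨g, hg⟩ u
    rw [hu, mul_one] at h2
    by_cases h1 : χ ⟨g, hg⟩ = 1
    · rw [← hχ, h1, Units.val_one] at h2
      have h3 : g = 1 := Units.ext (eq_one_of_isSemisimple (hfix g hg) hu h2 hss)
      rw [h3, orderOf_one]
      exact one_dvd _
    · obtain ⟨w, hw, hgw⟩ := exists_eigenvector (hfix g hg) hu
        (h2 ▸ fun h => h1 (Units.ext h))
      rw [orderOf_eq_of_eigenvector (hfix g hg) hw (h2 ▸ hgw), orderOf_units]
      obtain ⟨j, hj⟩ := hgen ⟨g, hg⟩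
      rw [← hχ, hj]
      exact orderOf_pow_dvd j

theorem mulVec_sub_mem_span_transvections {G : Subgroup (GL (Fin n) F)}
    {hfix : ∀ g ∈ G, ∀ v, l v = 0 → (g : Matrix (Fin n) (Fin n) F) *ᵥ v = v}
    {u z : Fin n → F} {hu : l u = 1} (hz : l z = 1) {g₀ : G}
    (hg₀ : (g₀ : GL (Fin n) F).val *ᵥ z = (hyperplaneCharacter G hfix hu g₀ : F) • z)
    (hgen : ∀ g : G, ∃ j : ℕ,
      hyperplaneCharacter G hfix hu g = hyperplaneCharacter G hfix hu g₀ ^ j) (g : G) :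
    (g : GL (Fin n) F).val *ᵥ z - (hyperplaneCharacter G hfix hu g : F) • z ∈
      Submodule.span F {α : Fin n → F | l α = 0 ∧ ∃ g ∈ G, ∀ v,
        (g : Matrix (Fin n) (Fin n) F) *ᵥ v = v + l v • α} := by
  set χ := hyperplaneCharacter G hfix hu with hχ
  obtain ⟨j, hj⟩ := hgen g
  set h : G := g * (g₀ ^ j)⁻¹ with hh
  have hχh : χ h = 1 := by rw [hh, map_mul, map_inv, map_pow, hj, mul_inv_cancel]
  have hgh : (g : GL (Fin n) F).val *ᵥ z = (χ g : F) • ((h : GL (Fin n) F).val *ᵥ z) := by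
    have h1 : g = h * g₀ ^ j := by rw [hh, inv_mul_cancel_right]
    conv_lhs => rw [h1]
    rw [Subgroup.coe_mul, Units.val_mul, ← Matrix.mulVec_mulVec, Subgroup.coe_pow,
      Units.val_pow_eq_pow_val, pow_mulVec_eigenvector hg₀, Matrix.mulVec_smul, hj,
      Units.val_pow_eq_pow_val]
  rw [hgh, ← smul_sub]
  refine Submodule.smul_mem _ _ (Submodule.subset_span
    ⟨?_, h, h.2, fun v => mulVec_eq_add_smul (hfix h h.2) hz v⟩)
  rw [map_sub, hyperplaneCharacter_apply G hfix hu h, ← hχ, hχh, hz]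
  simp

end Character

/-- For `G ⊆ GL_n(F_p)` fixing the hyperplane `H = ker l` pointwise, with transvection
root space dimension `ℓ` and maximal semisimple order `e`:
`Hilb((S/𝔪^{[p^m]})^G, t) = ((1−t^{p^m})/(1−t))^{n−ℓ−1}·((1−t^{p^m})/(1−t^p))^ℓ ·
( (1−t^{p^m−1})/(1−t^e) + t^{p^m−1}·((1−t^p)/(1−t))^ℓ )`, stated with denominators
cleared in `ℤ⟦t⟧`. -/
theorem stmt_11 (p n m ℓ e : ℕ) [Fact p.Prime] (hm : 1 ≤ m) (hn : 1 ≤ n) (hℓn : ℓ ≤ n - 1)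
    (G : Subgroup (GL (Fin n) (ZMod p)))
    (l : (Fin n → ZMod p) →ₗ[ZMod p] ZMod p) (hl : l ≠ 0)
    (hfix : ∀ g ∈ G, ∀ v, l v = 0 →
      Matrix.mulVec (g : Matrix (Fin n) (Fin n) (ZMod p)) v = v)
    (hℓ : Module.finrank (ZMod p) (Submodule.span (ZMod p)
      {α : Fin n → ZMod p | l α = 0 ∧ ∃ g ∈ G, ∀ v,
        Matrix.mulVec (g : Matrix (Fin n) (Fin n) (ZMod p)) v = v + l v • α}) = ℓ)
    (he : IsGreatest {k | ∃ g ∈ G, Module.End.IsSemisimple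
      (Matrix.toLin' (g : Matrix (Fin n) (Fin n) (ZMod p))) ∧ orderOf g = k} e) :
    invHilb G (p ^ m) * (1 - PowerSeries.X) ^ (n - ℓ - 1) * (1 - PowerSeries.X ^ p) ^ ℓ
        * (1 - PowerSeries.X ^ e) * (1 - PowerSeries.X) ^ ℓ
      = (1 - PowerSeries.X ^ p ^ m) ^ (n - 1)
          * ((1 - PowerSeries.X ^ (p ^ m - 1)) * (1 - PowerSeries.X) ^ ℓ
            + PowerSeries.X ^ (p ^ m - 1) * (1 - PowerSeries.X ^ e)
              * (1 - PowerSeries.X ^ p) ^ ℓ) := by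
  obtain ⟨u₀, hu₀⟩ : ∃ u, l u ≠ 0 := by
    by_contra! h
    exact hl (LinearMap.ext h)
  obtain ⟨u, hu⟩ : ∃ u, l u = 1 := ⟨(l u₀)⁻¹ • u₀, by simp [hu₀]⟩
  obtain ⟨z, hz, g₀, hg₀, hgen⟩ := exists_generating_eigenvector G hfix hu
  have hord := orderOf_hyperplaneCharacter_eq hz hg₀ hgen he
  have hspan := mulVec_sub_mem_span_transvections hz hg₀ hgen
  set χ := hyperplaneCharacter G hfix hu with hχ
  obtain ⟨b, T, k, hkT, rfl, hbl, hbT, hTspan, hTcard⟩ :=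
    exists_adapted_basis l hz (s := {α : Fin n → ZMod p | l α = 0 ∧ ∃ g ∈ G, ∀ v,
      Matrix.mulVec (g : Matrix (Fin n) (Fin n) (ZMod p)) v = v + l v • α}) fun v hv => hv.1
  rw [hℓ] at hTcard
  have hshear := fun g (hg : g ∈ G) =>
    gSub_conj_basisMatrix b (k := k) (g := g) fun i hi => hfix g hg _ (hbl i hi)
  have hβ : ∀ g : G, (∀ i, i ∉ T → i ≠ k →
      b.repr ((g : GL (Fin n) (ZMod p)).val *ᵥ b k - b k) i = 0) ∧
      1 + b.repr ((g : GL (Fin n) (ZMod p)).val *ᵥ b k - b k) k = χ g := by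
    intro g
    have hw := hspan g
    rw [← hTspan, b.mem_span_image] at hw
    set w := (g : GL (Fin n) (ZMod p)).val *ᵥ b k - (χ g : ZMod p) • b k with hwdef
    have hsub : (g : GL (Fin n) (ZMod p)).val *ᵥ b k - b k = w + ((χ g : ZMod p) - 1) • b k := by
      rw [hwdef, sub_smul, one_smul]; abel
    have hw0 : ∀ i, i ∉ T → b.repr w i = 0 := fun i hi => by
      by_contra h
      exact hi (hw (Finsupp.mem_support_iff.2 h))
    rw [hsub]
    refine ⟨fun i hi hik => ?_, ?_⟩
    · simp [hw0 i hi, hik.symm]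
    · simp [hw0 k hkT]
  have hp : p.Prime := Fact.out
  have he0 : 0 < e := hord ▸ orderOf_pos _
  have hdim : ∀ d, invPieceDim G (p ^ m) d = _ := fun d =>
    (invPieceDim_conj (basisMatrix b) G m d).symm.trans
      (invPieceDim_eq_card (e := e) hkT ?_ ?_ ?_ d)
  · have hPS : invHilb G (p ^ m) = _ := (congrArg PowerSeries.mk (funext fun d =>
      congrArg Nat.cast (hdim d))).trans (mk_card_filter_degree _)
    have hq : 0 < p ^ m := pow_pos hp.pos m
    rw [hPS, sum_isInvariantExponent _ hq hkT, hTcard]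
    refine sum_isInvariantExponent_mul hℓn (geom_sum_mul_neg _ _) ?_ ?_
    · obtain ⟨K, hK⟩ : p ∣ p ^ m := dvd_pow_self p (by omega)
      rw [hK]
      exact sum_filter_dvd_pow_mul _ hp.pos K
    · obtain ⟨K, hK⟩ : e ∣ p ^ m - 1 := by
        rw [← hord, ← orderOf_units]
        exact orderOf_dvd_of_pow_eq_one (zmod_pow_prime_pow_sub_one (χ g₀).ne_zero m)
      rw [hK]
      exact sum_filter_dvd_pow_mul _ he0 K
  · rintro _ ⟨g, hg, rfl⟩
    refine ⟨_, (hβ ⟨g, hg⟩).1, ?_, ?_, by simpa using hshear g hg⟩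
    · rw [(hβ ⟨g, hg⟩).2]
      exact Units.ne_zero _
    · obtain ⟨j, hj⟩ := hgen ⟨g, hg⟩
      rw [(hβ ⟨g, hg⟩).2, ← Units.val_pow_eq_pow_val, hj, ← pow_mul, mul_comm, pow_mul, ← hord,
        pow_orderOf_eq_one, one_pow, Units.val_one]
  · intro i hi
    obtain ⟨-, g, hg, hgi⟩ := hbT i hi
    refine ⟨_, Subgroup.mem_map_of_mem _ hg, ?_⟩
    have h := hshear g hg
    rw [hgi, hz, one_smul, add_sub_cancel_left, b.repr_self, Finsupp.single_eq_pi_single] at h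
    simpa using h
  · refine ⟨_, Subgroup.mem_map_of_mem _ g₀.2, _, (hβ g₀).1, ?_, ?_, by
      simpa using hshear g₀ g₀.2⟩
    · rw [(hβ g₀).2]
      exact Units.ne_zero _
    · rw [(hβ g₀).2, orderOf_units, hord]
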